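/- Let K be a field whose characteristic is not 2, and let L be the set of seven Fano lines, i.e., the 3-element subsets {1,2,3}, {1,4,5}, {1,6,7}, {2,4,6}, {2,5,7}, {3,4,7}, {3,5,6} of {1,…,7}. Then there is no map v from {1,…,7} to K³ such that for every 3-element subset T of {1,…,7}, the family of vectors (v(t))_{t∈T} is linearly dependent over K if and only if T ∈ L. -/

import Mathlib

/-- The seven lines of the Fano plane `PG₂(2)` on the points `{1,…,7}`,
here identified with `Fin 7` via `1 ↦ 0, …, 7 ↦ 6`. -/
def fanoLines : Finset (Finset (Fin 7)) :=
  { {0, 1, 2}, {0, 3, 4}, {0, 5, 6}, {1, 3, 5}, {1, 4, 6}, {2, 3, 6}, {2, 4, 5} }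

/-- The vectors indexed by three distinct points are linearly independent if and only if
their determinant does not vanish. -/
lemma linearIndependent_triple_iff_det_ne_zero {K ι : Type*} [Field K] [DecidableEq ι]
    (v : ι → Fin 3 → K) {i j k : ι} (hij : i ≠ j) (hik : i ≠ k) (hjk : j ≠ k) :
    LinearIndependent K (fun t : ({i, j, k} : Finset ι) => v t) ↔
      (Matrix.of ![v i, v j, v k]).det ≠ 0 := by
  let g : Fin 3 → ({i, j, k} : Finset ι) :=
    ![⟨i, by simp⟩, ⟨j, by simp⟩, ⟨k, by simp⟩]
  have hg : Function.Bijective g := by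
    constructor
    · intro a b hab
      fin_cases a <;> fin_cases b <;> simp_all [g, Ne.symm]
    · rintro ⟨t, ht⟩
      simp only [Finset.mem_insert, Finset.mem_singleton] at ht
      rcases ht with rfl | rfl | rfl
      exacts [⟨0, rfl⟩, ⟨1, rfl⟩, ⟨2, rfl⟩]
  rw [← linearIndependent_equiv (Equiv.ofBijective g hg), ← isUnit_iff_ne_zero,
    ← Matrix.isUnit_iff_isUnit_det, ← Matrix.linearIndependent_rows_iff_isUnit]
  have hrow : (fun t : ({i, j, k} : Finset ι) => v t) ∘ Equiv.ofBijective g hg =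
      (Matrix.of ![v i, v j, v k]).row := by
    funext a
    fin_cases a <;> rfl
  rw [hrow]

/-- Three-term Grassmann–Plücker relation. -/
lemma det_mul_det_eq_sub {R : Type*} [CommRing R] (p q r u w : Fin 3 → R) :
    (Matrix.of ![p, q, r]).det * (Matrix.of ![p, u, w]).det =
      (Matrix.of ![p, u, r]).det * (Matrix.of ![p, q, w]).det -
        (Matrix.of ![p, q, u]).det * (Matrix.of ![p, w, r]).det := by
  simp [Matrix.det_fin_three]
  ring

/-- The determinant of three vectors in terms of their Cramer coordinates with respect to
`p`, `q`, `r`. -/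
lemma det_sq_mul_det_eq {R : Type*} [CommRing R] (p q r u w x : Fin 3 → R) :
    (Matrix.of ![p, q, r]).det ^ 2 * (Matrix.of ![u, w, x]).det =
      (Matrix.of fun a : Fin 3 => ![(Matrix.of ![![u, w, x] a, q, r]).det,
        (Matrix.of ![p, ![u, w, x] a, r]).det, (Matrix.of ![p, q, ![u, w, x] a]).det]).det := by
  simp [Matrix.det_fin_three]
  ring

/-- Non-realizability of the Fano matroid over fields of characteristic different
from 2 ("How to draw tropical planes", Section 3): there is no configuration of seven
vectors in `K³` whose dependent triples are exactly the Fano lines. -/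
theorem fano_not_realizable (K : Type*) [Field K] (hchar : ringChar K ≠ 2) :
    ¬ ∃ v : Fin 7 → (Fin 3 → K),
      ∀ T : Finset (Fin 7), T.card = 3 →
        (¬ LinearIndependent K (fun t : T => v t) ↔ T ∈ fanoLines) := by
  rintro ⟨v, hv⟩
  let D : Fin 7 → Fin 7 → Fin 7 → K := fun i j k => (Matrix.of ![v i, v j, v k]).det
  have key (i j k : Fin 7) (h : i ≠ j ∧ i ≠ k ∧ j ≠ k) :
      D i j k = 0 ↔ ({i, j, k} : Finset (Fin 7)) ∈ fanoLines := by
    rw [← hv _ (Finset.card_eq_three.2 ⟨i, j, k, h.1, h.2.1, h.2.2, rfl⟩),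
      linearIndependent_triple_iff_det_ne_zero v h.1 h.2.1 h.2.2, not_not]
  have line (i j k : Fin 7) (h : (i ≠ j ∧ i ≠ k ∧ j ≠ k) ∧ ({i, j, k} : Finset (Fin 7)) ∈ fanoLines) :
      D i j k = 0 := (key i j k h.1).2 h.2
  have basis (i j k : Fin 7) (h : (i ≠ j ∧ i ≠ k ∧ j ≠ k) ∧ ({i, j, k} : Finset (Fin 7)) ∉ fanoLines) :
      D i j k ≠ 0 := fun h0 => h.2 ((key i j k h.1).1 h0)
  have rot (i j k : Fin 7) : D i j k = D j k i := by
    simp only [D, Matrix.det_fin_three]; simp; ring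
  have plucker (p q r u w : Fin 7) : D p q r * D p u w = D p u r * D p q w - D p q u * D p w r :=
    det_mul_det_eq_sub _ _ _ _ _
  have h056 : D 0 5 3 * D 0 1 6 = D 0 1 5 * D 0 6 3 := by
    linear_combination D 0 1 3 * line 0 5 6 (by decide) - plucker 0 1 3 5 6
  have h146 : D 0 1 4 * D 6 1 3 = D 4 1 3 * D 0 1 6 := by
    rw [rot 0 1 4, rot 6 1 3, rot 4 1 3, rot 0 1 6]
    linear_combination D 1 3 0 * line 1 4 6 (by decide) - plucker 1 3 0 4 6
  have h326 : D 2 1 3 * D 0 6 3 = D 0 2 3 * D 6 1 3 := by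
    rw [rot 2 1 3, rot 1 3 2, rot 0 6 3, rot 6 3 0, rot 0 2 3, rot 2 3 0, rot 6 1 3, rot 1 3 6]
    linear_combination D 3 0 1 * line 3 2 6 (by decide) - plucker 3 0 1 2 6
  have h245 : D 2 1 3 * D 0 1 4 * D 0 5 3 + D 0 2 3 * D 4 1 3 * D 0 1 5 = 0 := by
    have h : D 0 1 3 ^ 2 * D 2 4 5 = (Matrix.of ![![D 2 1 3, D 0 2 3, D 0 1 2],
        ![D 4 1 3, D 0 4 3, D 0 1 4], ![D 5 1 3, D 0 5 3, D 0 1 5]]).det := by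
      refine (det_sq_mul_det_eq (v 0) (v 1) (v 3) (v 2) (v 4) (v 5)).trans (congrArg _ ?_)
      ext a b
      fin_cases a <;> rfl
    rw [line 2 4 5 (by decide), line 0 1 2 (by decide), line 0 4 3 (by decide),
      line 5 1 3 (by decide)] at h
    simp [Matrix.det_fin_three] at h
    linear_combination h
  have h2 : (2 : K) ≠ 0 := Ring.two_ne_zero hchar
  have hne : 2 * (D 2 1 3 * D 0 1 4 * D 0 5 3) * (D 6 1 3 * D 0 6 3 * D 0 1 6) ≠ 0 := by
    simp only [ne_eq, mul_eq_zero, not_or]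
    refine ⟨⟨h2, ⟨?_, ?_⟩, ?_⟩, ⟨?_, ?_⟩, ?_⟩ <;> exact basis _ _ _ (by decide)
  apply hne
  linear_combination (D 6 1 3 * D 0 6 3 * D 0 1 6) * h245 +
    (D 2 1 3 * D 0 6 3 * D 0 1 4 * D 6 1 3) * h056 +
    (D 2 1 3 * D 0 6 3 * D 0 1 5 * D 0 6 3) * h146 +
    (D 4 1 3 * D 0 1 6 * D 0 1 5 * D 0 6 3) * h326
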